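/- Let f be a probability density on (0,∞), let b : [0,∞) → ℝ be continuous with t ↦ b(t) + α·t bounded below on [0,∞) for every α > 0, and assume there exists ε > 0 such that ∫₀^ε exp(β·b(t)/√t)·f(t) dt < ∞ for every β > 0. Define r(α) := ∫₀^∞ exp(−α·b(t) − α²·t/2)·f(t) dt for α > 0. Then r is infinitely differentiable on (0,∞), and for every integer n ≥ 0 and every α > 0 the integral below converges absolutely and (−1)^n·r^{(n)}(α) = ∫₀^∞ (t/2)^{n/2}·exp(−α·b(t) − α²·t/2)·H_n((b(t) + α·t)/√(2t))·f(t) dt. -/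

import Mathlib

open MeasureTheory Real Set

/-- The physicists' Hermite polynomial of degree `n`,
`H_n(x) = (−1)^n e^{x²} (d/dx)^n e^{−x²}`. -/
noncomputable def physHermite (n : ℕ) (x : ℝ) : ℝ :=
  (-1) ^ n * Real.exp (x ^ 2) * iteratedDeriv n (fun y => Real.exp (-y ^ 2)) x

theorem iteratedDeriv_exp_neg_sq_eq_polynomial_mul (n : ℕ) :
    ∃ p : Polynomial ℝ, p.natDegree ≤ n ∧
      iteratedDeriv n (fun y : ℝ => Real.exp (-y ^ 2)) = fun x => p.eval x * Real.exp (-x ^ 2) := by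
  induction n with
  | zero => exact ⟨1, by simp, by simp⟩
  | succ n ih =>
    obtain ⟨p, hp, h⟩ := ih
    refine ⟨Polynomial.derivative p - Polynomial.C 2 * Polynomial.X * p, ?_, ?_⟩
    · refine (Polynomial.natDegree_sub_le _ _).trans (max_le ?_ ?_)
      · exact (Polynomial.natDegree_derivative_le p).trans (by omega)
      · refine Polynomial.natDegree_mul_le.trans ?_
        have : (Polynomial.C (2 : ℝ) * Polynomial.X).natDegree ≤ 1 := by compute_degree
        omega
    · rw [iteratedDeriv_succ, h]
      ext x
      have hg : HasDerivAt (fun y : ℝ => Real.exp (-y ^ 2)) (Real.exp (-x ^ 2) * -(2 * x)) x := by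
        simpa using ((hasDerivAt_pow 2 x).neg).exp
      refine ((p.hasDerivAt x).mul hg).deriv.trans ?_
      simp
      ring

theorem abs_polynomial_eval_le (p : Polynomial ℝ) {n : ℕ} (hp : p.natDegree ≤ n) :
    ∃ C : ℝ, 0 ≤ C ∧ ∀ x, |p.eval x| ≤ C * (1 + |x|) ^ n := by
  refine ⟨∑ i ∈ Finset.range (p.natDegree + 1), |p.coeff i|,
    Finset.sum_nonneg fun _ _ => abs_nonneg _, fun x => ?_⟩
  rw [Polynomial.eval_eq_sum_range, Finset.sum_mul]
  refine (Finset.abs_sum_le_sum_abs _ _).trans (Finset.sum_le_sum fun i hi => ?_)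
  rw [abs_mul, abs_pow]
  have hi' : i ≤ n := by have := Finset.mem_range.1 hi; omega
  gcongr
  calc |x| ^ i ≤ (1 + |x|) ^ i := by gcongr; linarith
    _ ≤ (1 + |x|) ^ n := pow_le_pow_right₀ (by linarith [abs_nonneg x]) hi'

theorem differentiable_iteratedDeriv_exp_neg_sq (n : ℕ) :
    Differentiable ℝ (iteratedDeriv n (fun y : ℝ => Real.exp (-y ^ 2))) := by
  have h : ContDiff ℝ (n + 1) (fun y : ℝ => Real.exp (-y ^ 2)) := by fun_prop
  exact h.differentiable_iteratedDeriv n (by exact_mod_cast Nat.lt_succ_self n)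

/-- The `n`-th `α`-derivative of `exp (-α * β - α ^ 2 * t / 2)`. -/
noncomputable def boundaryKernel (β : ℝ) (n : ℕ) (α t : ℝ) : ℝ :=
  Real.exp (β ^ 2 / (2 * t)) * √(t / 2) ^ n *
    iteratedDeriv n (fun y : ℝ => Real.exp (-y ^ 2)) ((β + α * t) / √(2 * t))

theorem sqrt_two_mul_mul_sqrt_half {t : ℝ} (ht : 0 < t) : √(2 * t) * √(t / 2) = t := by
  rw [← Real.sqrt_mul (by positivity), show 2 * t * (t / 2) = t ^ 2 by ring,
    Real.sqrt_sq ht.le]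

theorem exp_neg_sq_mul_exp_eq {t : ℝ} (ht : 0 < t) (α β : ℝ) :
    Real.exp (β ^ 2 / (2 * t)) * Real.exp (-((β + α * t) / √(2 * t)) ^ 2) =
      Real.exp (-α * β - α ^ 2 * t / 2) := by
  rw [← Real.exp_add, div_pow, Real.sq_sqrt (by positivity)]
  congr 1
  field_simp
  ring

theorem boundaryKernel_eq_physHermite {t : ℝ} (ht : 0 < t) (α β : ℝ) (n : ℕ) :
    (t / 2) ^ ((n : ℝ) / 2) * Real.exp (-α * β - α ^ 2 * t / 2)
      * physHermite n ((β + α * t) / √(2 * t)) = (-1) ^ n * boundaryKernel β n α t := by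
  have hs : (t / 2) ^ ((n : ℝ) / 2) = √(t / 2) ^ n := by
    rw [Real.sqrt_eq_rpow, ← Real.rpow_mul_natCast (by positivity)]
    congr 1
    ring
  rw [hs, physHermite, boundaryKernel, ← exp_neg_sq_mul_exp_eq ht, Real.exp_neg]
  field_simp

theorem hasDerivAt_boundaryKernel {t : ℝ} (ht : 0 < t) (β : ℝ) (n : ℕ) (α : ℝ) :
    HasDerivAt (fun α => boundaryKernel β n α t) (boundaryKernel β (n + 1) α t) α := by
  have hx : HasDerivAt (fun α => (β + α * t) / √(2 * t)) (√(t / 2)) α := by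
    have h := (((hasDerivAt_id α).mul_const t).const_add β).div_const (√(2 * t))
    have ht' : 1 * t / √(2 * t) = √(t / 2) := by
      rw [div_eq_iff (by positivity), one_mul, mul_comm, sqrt_two_mul_mul_sqrt_half ht]
    rwa [ht'] at h
  have hG := (differentiable_iteratedDeriv_exp_neg_sq n ((β + α * t) / √(2 * t))).hasDerivAt
  rw [← iteratedDeriv_succ] at hG
  refine ((hG.comp α hx).const_mul (Real.exp (β ^ 2 / (2 * t)) * √(t / 2) ^ n)).congr_deriv ?_
  rw [boundaryKernel]
  ring

theorem continuousOn_boundaryKernel {b : ℝ → ℝ} (hb : ContinuousOn b (Ioi 0)) (n : ℕ) (α : ℝ) :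
    ContinuousOn (fun t => boundaryKernel (b t) n α t) (Ioi 0) := by
  have hG := (differentiable_iteratedDeriv_exp_neg_sq n).continuous
  unfold boundaryKernel
  have h2 : ∀ t ∈ Ioi (0 : ℝ), 2 * t ≠ 0 := fun t ht => by
    have : 0 < t := ht
    positivity
  have h3 : ∀ t ∈ Ioi (0 : ℝ), √(2 * t) ≠ 0 := fun t ht => by
    have : 0 < t := ht
    positivity
  refine ContinuousOn.mul (ContinuousOn.mul ?_ ?_) (hG.comp_continuousOn ?_)
  · exact ((hb.pow 2).div (by fun_prop) h2).rexp
  · fun_prop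
  · exact (hb.add (by fun_prop)).div (by fun_prop) h3

theorem abs_boundaryKernel_le (n : ℕ) :
    ∃ C : ℝ, 0 ≤ C ∧ ∀ α β t : ℝ, 0 < t →
      |boundaryKernel β n α t| ≤
        C * (1 + t + |β + α * t|) ^ n * Real.exp (-α * β - α ^ 2 * t / 2) := by
  obtain ⟨p, hp, h⟩ := iteratedDeriv_exp_neg_sq_eq_polynomial_mul n
  obtain ⟨C, hC, hpC⟩ := abs_polynomial_eval_le p hp
  refine ⟨C, hC, fun α β t ht => ?_⟩
  set x := (β + α * t) / √(2 * t) with hx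
  have hxs : √(t / 2) * |x| = |β + α * t| / 2 := by
    have h1 : √(t / 2) / √(2 * t) = 1 / 2 := by
      rw [← Real.sqrt_div' _ (by positivity), show t / 2 / (2 * t) = (1 / 2) ^ 2 by
        field_simp, Real.sqrt_sq (by norm_num)]
    rw [hx, abs_div, abs_of_nonneg (Real.sqrt_nonneg (2 * t))]
    calc √(t / 2) * (|β + α * t| / √(2 * t)) = |β + α * t| * (√(t / 2) / √(2 * t)) := by ring
      _ = _ := by rw [h1]; ring
  have hs : √(t / 2) ≤ 1 + t := by
    rw [Real.sqrt_le_left (by positivity)]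
    nlinarith
  have hbase : √(t / 2) * (1 + |x|) ≤ 1 + t + |β + α * t| := by
    rw [mul_add, hxs]
    linarith [abs_nonneg (β + α * t)]
  have heq : boundaryKernel β n α t =
      √(t / 2) ^ n * p.eval x * Real.exp (-α * β - α ^ 2 * t / 2) := by
    rw [boundaryKernel, h, ← exp_neg_sq_mul_exp_eq ht]
    ring
  rw [heq, abs_mul, abs_mul, Real.abs_exp, abs_of_nonneg (pow_nonneg (Real.sqrt_nonneg _) n)]
  refine mul_le_mul_of_nonneg_right ?_ (Real.exp_pos _).le
  calc √(t / 2) ^ n * |p.eval x| ≤ √(t / 2) ^ n * (C * (1 + |x|) ^ n) := by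
        gcongr
        exact hpC x
    _ = C * (√(t / 2) * (1 + |x|)) ^ n := by rw [mul_pow]; ring
    _ ≤ C * (1 + t + |β + α * t|) ^ n := by gcongr

theorem pow_mul_exp_neg_mul_le {c : ℝ} (hc : 0 < c) (n : ℕ) {y : ℝ} (hy : 0 ≤ y) :
    y ^ n * Real.exp (-(c * y)) ≤ n.factorial / c ^ n := by
  have h := Real.pow_div_factorial_le_exp (c * y) (by positivity) n
  rw [div_le_iff₀ (by positivity), mul_pow] at h
  rw [Real.exp_neg, ← div_eq_mul_inv, div_le_div_iff₀ (Real.exp_pos _) (by positivity)]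
  linarith

theorem exists_bound_boundaryKernel {b : ℝ → ℝ}
    (hbdd : ∀ α > (0 : ℝ), ∃ m : ℝ, ∀ t ∈ Ici (0 : ℝ), m ≤ b t + α * t)
    (n : ℕ) {a₀ a₁ : ℝ} (ha₀ : 0 < a₀) :
    ∃ C : ℝ, ∀ α ∈ Icc a₀ a₁, ∀ t ∈ Ioi (0 : ℝ), |boundaryKernel (b t) n α t| ≤ C := by
  rcases lt_or_ge a₁ a₀ with hlt | hle
  · exact ⟨0, fun α hα => absurd (hα.1.trans hα.2) (not_le.2 hlt)⟩
  have ha₁ : 0 < a₁ := ha₀.trans_le hle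
  obtain ⟨C, hC, hker⟩ := abs_boundaryKernel_le n
  obtain ⟨m, hm⟩ := hbdd (a₀ / 8) (by positivity)
  set M := |m| with hM
  have hM0 : 0 ≤ M := abs_nonneg m
  set c := min a₀ (a₀ ^ 2 / 4) with hc
  have hc0 : 0 < c := by positivity
  set D := 1 + M + a₀ + a₁ with hD
  have hD1 : 1 ≤ D := by linarith
  refine ⟨C * (D ^ n * (Real.exp (a₁ * M) * Real.exp c * (n.factorial / c ^ n))),
    fun α hα t ht => ?_⟩
  have ht0 : 0 < t := ht
  have hα0 : 0 < α := ha₀.trans_le hα.1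
  set v := b t + a₀ / 8 * t + M with hv
  have hv0 : 0 ≤ v := by
    have := hm t ht0.le
    have := neg_abs_le m
    linarith
  have h1 : 1 + t + |b t + α * t| ≤ D * (1 + v + t) := by
    have hbt : |b t + α * t| ≤ v + M + (a₀ + a₁) * t := by
      have hαt : α * t ≤ a₁ * t := by gcongr; exact hα.2
      have hαt0 : 0 ≤ α * t := by positivity
      have hat : 0 ≤ a₀ * t := by positivity
      rw [abs_le]
      constructor <;> linarith
    have e1 : 0 ≤ (D - 1) * v := mul_nonneg (by linarith) hv0
    have e2 : 0 ≤ M * t := by positivity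
    have e3 : D * (1 + v + t) = 1 + M + a₀ + a₁ + v + (D - 1) * v + t + M * t + (a₀ + a₁) * t := by
      rw [hD]; ring
    linarith
  have h2 : -α * b t - α ^ 2 * t / 2 ≤ a₁ * M + c + -(c * (1 + v + t)) := by
    have e1 : α * M ≤ a₁ * M := by gcongr; exact hα.2
    have e2 : c * v ≤ α * v := by gcongr; exact (min_le_left _ _).trans hα.1
    have e3 : c * t ≤ a₀ ^ 2 / 4 * t := by gcongr; exact min_le_right _ _
    have e4 : a₀ ^ 2 / 4 * t ≤ (α ^ 2 / 2 - α * a₀ / 8) * t := by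
      gcongr
      nlinarith [hα.1]
    have e5 : -α * b t = -(α * v) + α * (a₀ / 8 * t) + α * M := by rw [hv]; ring
    linarith
  calc |boundaryKernel (b t) n α t|
      ≤ C * (1 + t + |b t + α * t|) ^ n * Real.exp (-α * b t - α ^ 2 * t / 2) := hker _ _ _ ht0
    _ ≤ C * (D * (1 + v + t)) ^ n * Real.exp (a₁ * M + c + -(c * (1 + v + t))) := by gcongr
    _ = C * (D ^ n * (Real.exp (a₁ * M) * Real.exp c *
          ((1 + v + t) ^ n * Real.exp (-(c * (1 + v + t)))))) := by
        rw [mul_pow, Real.exp_add, Real.exp_add]; ring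
    _ ≤ _ := by
        gcongr
        exact pow_mul_exp_neg_mul_le hc0 n (by positivity)

section Transform

variable {f b : ℝ → ℝ}

theorem integrableOn_boundaryKernel_mul (hf : IntegrableOn f (Ioi 0))
    (hb : ContinuousOn b (Ioi 0))
    (hbdd : ∀ α > (0 : ℝ), ∃ m : ℝ, ∀ t ∈ Ici (0 : ℝ), m ≤ b t + α * t)
    (n : ℕ) {α : ℝ} (hα : 0 < α) :
    IntegrableOn (fun t => boundaryKernel (b t) n α t * f t) (Ioi 0) := by
  obtain ⟨C, hC⟩ := exists_bound_boundaryKernel hbdd n (a₁ := α) hα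
  refine Integrable.bdd_mul (c := C) hf
    ((continuousOn_boundaryKernel hb n α).aestronglyMeasurable measurableSet_Ioi) ?_
  filter_upwards [ae_restrict_mem measurableSet_Ioi] with t ht
  exact hC α ⟨le_rfl, le_rfl⟩ t ht

theorem hasDerivAt_integral_boundaryKernel (hf : IntegrableOn f (Ioi 0))
    (hb : ContinuousOn b (Ioi 0))
    (hbdd : ∀ α > (0 : ℝ), ∃ m : ℝ, ∀ t ∈ Ici (0 : ℝ), m ≤ b t + α * t)
    (n : ℕ) {α : ℝ} (hα : 0 < α) :
    HasDerivAt (fun α => ∫ t in Ioi (0 : ℝ), boundaryKernel (b t) n α t * f t)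
      (∫ t in Ioi (0 : ℝ), boundaryKernel (b t) (n + 1) α t * f t) α := by
  obtain ⟨C, hC⟩ := exists_bound_boundaryKernel hbdd (n + 1) (a₀ := α / 2) (a₁ := 2 * α)
    (by positivity)
  have hs : Icc (α / 2) (2 * α) ∈ nhds α := Icc_mem_nhds (by linarith) (by linarith)
  refine (hasDerivAt_integral_of_dominated_loc_of_deriv_le
    (F := fun a t => boundaryKernel (b t) n a t * f t)
    (F' := fun a t => boundaryKernel (b t) (n + 1) a t * f t) (bound := fun t => C * |f t|) hs
    ?_ (integrableOn_boundaryKernel_mul hf hb hbdd n hα)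
    (integrableOn_boundaryKernel_mul hf hb hbdd (n + 1) hα).aestronglyMeasurable
    ?_ (hf.abs.const_mul C) ?_).2
  · filter_upwards [Ioi_mem_nhds hα] with a ha
    exact (integrableOn_boundaryKernel_mul hf hb hbdd n ha).aestronglyMeasurable
  · filter_upwards [ae_restrict_mem measurableSet_Ioi] with t ht a ha
    rw [Real.norm_eq_abs, abs_mul]
    gcongr
    exact hC a ha t ht
  · filter_upwards [ae_restrict_mem measurableSet_Ioi] with t ht a _
    exact (hasDerivAt_boundaryKernel ht (b t) n a).mul_const (f t)

end Transform

theorem iteratedDerivWithin_eqOn_of_hasDerivAt_succ {s : Set ℝ} (hs : IsOpen s) {F : ℕ → ℝ → ℝ}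
    (hF : ∀ n, ∀ x ∈ s, HasDerivAt (F n) (F (n + 1) x) x) (n : ℕ) :
    EqOn (iteratedDerivWithin n (F 0) s) (F n) s := by
  induction n with
  | zero => intro x _; simp
  | succ n ih =>
    intro x hx
    rw [iteratedDerivWithin_succ, derivWithin_congr ih (ih hx)]
    exact (hF n x hx).hasDerivWithinAt.derivWithin (hs.uniqueDiffWithinAt hx)

theorem contDiffOn_of_hasDerivAt_succ {s : Set ℝ} (hs : IsOpen s) {F : ℕ → ℝ → ℝ}
    (hF : ∀ n, ∀ x ∈ s, HasDerivAt (F n) (F (n + 1) x) x) :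
    ContDiffOn ℝ ((⊤ : ℕ∞) : WithTop ℕ∞) (F 0) s :=
  contDiffOn_of_differentiableOn_deriv fun n _ =>
    DifferentiableOn.congr (fun x hx => (hF n x hx).differentiableAt.differentiableWithinAt)
      (iteratedDerivWithin_eqOn_of_hasDerivAt_succ hs hF n)

/-- **Derivatives of the boundary transform.** `r(α) = ∫₀^∞ e^{−αb(t)−α²t/2} f(t) dt` is
infinitely differentiable on `(0,∞)` and its signed `n`-th derivatives are given by
absolutely convergent Hermite-weighted integrals. -/
theorem boundary_transform_iterated_deriv
    (f : ℝ → ℝ) (hfmeas : Measurable f) (hfnonneg : ∀ t ∈ Ioi (0 : ℝ), 0 ≤ f t)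
    (hfint : ∫ t in Ioi (0 : ℝ), f t = 1)
    (b : ℝ → ℝ) (hb : ContinuousOn b (Ici 0))
    (hbdd : ∀ α > (0 : ℝ), ∃ m : ℝ, ∀ t ∈ Ici (0 : ℝ), m ≤ b t + α * t)
    (hsmall : ∃ ε > (0 : ℝ), ∀ β > (0 : ℝ),
      IntegrableOn (fun t => Real.exp (β * b t / Real.sqrt t) * f t) (Ioo 0 ε))
    (r : ℝ → ℝ)
    (hr : ∀ α, r α = ∫ t in Ioi (0 : ℝ), Real.exp (-α * b t - α ^ 2 * t / 2) * f t) :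
    ContDiffOn ℝ ((⊤ : ℕ∞) : WithTop ℕ∞) r (Ioi 0) ∧
    ∀ n : ℕ, ∀ α > (0 : ℝ),
      IntegrableOn (fun t => (t / 2) ^ ((n : ℝ) / 2) * Real.exp (-α * b t - α ^ 2 * t / 2)
          * physHermite n ((b t + α * t) / Real.sqrt (2 * t)) * f t) (Ioi 0) ∧
      (-1 : ℝ) ^ n * iteratedDerivWithin n r (Ioi 0) α
        = ∫ t in Ioi (0 : ℝ), (t / 2) ^ ((n : ℝ) / 2) * Real.exp (-α * b t - α ^ 2 * t / 2)
            * physHermite n ((b t + α * t) / Real.sqrt (2 * t)) * f t := by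
  have hf : IntegrableOn f (Ioi 0) := by
    by_contra h
    rw [integral_undef h] at hfint
    exact zero_ne_one hfint
  have hb' : ContinuousOn b (Ioi 0) := hb.mono Ioi_subset_Ici_self
  set F : ℕ → ℝ → ℝ := fun n α => ∫ t in Ioi (0 : ℝ), boundaryKernel (b t) n α t * f t with hFdef
  have hF : ∀ n, ∀ α ∈ Ioi (0 : ℝ), HasDerivAt (F n) (F (n + 1) α) α := fun n α hα =>
    hasDerivAt_integral_boundaryKernel hf hb' hbdd n hα
  have hr0 : r = F 0 := by
    ext α
    rw [hr]
    refine setIntegral_congr_fun measurableSet_Ioi fun t ht => ?_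
    simp only [boundaryKernel, pow_zero, mul_one, iteratedDeriv_zero,
      exp_neg_sq_mul_exp_eq (mem_Ioi.1 ht)]
  refine ⟨hr0 ▸ contDiffOn_of_hasDerivAt_succ isOpen_Ioi hF, fun n α hα => ?_⟩
  have hcongr : EqOn (fun t => (t / 2) ^ ((n : ℝ) / 2) * Real.exp (-α * b t - α ^ 2 * t / 2)
      * physHermite n ((b t + α * t) / Real.sqrt (2 * t)) * f t)
      (fun t => (-1) ^ n * (boundaryKernel (b t) n α t * f t)) (Ioi 0) := fun t ht => by
    simp only [boundaryKernel_eq_physHermite (mem_Ioi.1 ht), mul_assoc]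
  constructor
  · rw [integrableOn_congr_fun hcongr measurableSet_Ioi]
    exact (integrableOn_boundaryKernel_mul hf hb' hbdd n hα).const_mul _
  · rw [setIntegral_congr_fun measurableSet_Ioi hcongr, integral_const_mul, hr0,
      iteratedDerivWithin_eqOn_of_hasDerivAt_succ isOpen_Ioi hF n hα]
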